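/- arXiv:2301.01177 — 2 statements merged into one kernel-verified Lean document; each statement's English description precedes it below -/
import Mathlib

section
/- Let Z = ⟨z⟩ be a central subgroup of order 2 of a finite group G and ζ the nontrivial character of Z. Then the number of real-valued irreducible characters of G lying over ζ equals the number of real splitting conjugacy classes of G/Z minus twice the number of real splitting conjugacy classes of G/Z that are images of non-real conjugacy classes of G. -/
open scoped Classical

noncomputable section Defs

/-- `χ` is the character of some finite-dimensional complex representation of `G`. -/
def IsChar (G : Type*) [Group G] [Fintype G] (χ : G → ℂ) : Prop :=
  ∃ (n : ℕ) (ρ : Representation ℂ G (Fin n → ℂ)),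
    ∀ g : G, χ g = LinearMap.trace ℂ (Fin n → ℂ) (ρ g)

/-- `χ` is an irreducible character of `G` (a character of norm one). -/
def IsIrrChar (G : Type*) [Group G] [Fintype G] (χ : G → ℂ) : Prop :=
  IsChar G χ ∧ ∑ g : G, χ g * (starRingEnd ℂ) (χ g) = (Fintype.card G : ℂ)

/-- `χ` is a real-valued class function. -/
def IsRealChar (G : Type*) (χ : G → ℂ) : Prop :=
  ∀ g : G, (starRingEnd ℂ) (χ g) = χ g

variable {G : Type*} [Group G] [Fintype G]

/-- extension of a function on a subgroup by zero. -/
def ext0 (H : Subgroup G) (θ : ↥H → ℂ) (g : G) : ℂ :=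
  if h : g ∈ H then θ ⟨g, h⟩ else 0

/-- the character of `G` induced from the character `θ` of the subgroup `H`. -/
def Ind (H : Subgroup G) (θ : ↥H → ℂ) (g : G) : ℂ :=
  (∑ x : G, ext0 H θ (x * g * x⁻¹)) / (Nat.card H : ℂ)

/-- the character of an intermediate subgroup `K` (with `H ≤ K`) induced from `θ` on `H`. -/
def IndTo (H K : Subgroup G) (θ : ↥H → ℂ) (k : ↥K) : ℂ :=
  (∑ x : ↥K, ext0 H θ (↑x * ↑k * (↑x)⁻¹)) / (Nat.card H : ℂ)

/-- the usual inner product of class functions on `H`. -/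
def innerChar (H : Subgroup G) (φ ψ : ↥H → ℂ) : ℂ :=
  (∑ h : ↥H, φ h * (starRingEnd ℂ) (ψ h)) / (Nat.card H : ℂ)

/-- the conjugate character `θ^g : n ↦ θ (g n g⁻¹)`. -/
def conjChar (H : Subgroup G) (θ : ↥H → ℂ) (g : G) : ↥H → ℂ :=
  fun n => ext0 H θ (g * ↑n * g⁻¹)

/-- the Frobenius–Schur indicator. -/
def FSind (H : Type*) [Group H] [Fintype H] (χ : H → ℂ) : ℂ :=
  (∑ h : H, χ (h ^ 2)) / (Fintype.card H : ℂ)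

/-- the Gow indicator `ε_t(θ) = (1/|N|) ∑_{n ∈ N} θ((nt)²)`. -/
def Gow (H : Subgroup G) (θ : ↥H → ℂ) (t : G) : ℂ :=
  (∑ n : ↥H, ext0 H θ ((↑n * t) ^ 2)) / (Nat.card H : ℂ)

end Defs

section Helpers

open Representation Module

open scoped ComplexOrder in
lemma isChar_inv {G : Type*} [Group G] [Fintype G] {χ : G → ℂ} (h : IsChar G χ) (g : G) :
    χ g⁻¹ = (starRingEnd ℂ) (χ g) := by
  obtain ⟨n, ρ, hρ⟩ := h
  let M : G → Matrix (Fin n) (Fin n) ℂ := fun g => LinearMap.toMatrix' (ρ g)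
  have hM1 : M 1 = 1 := by simp [M]
  have hMm : ∀ a b, M (a * b) = M a * M b := by
    intro a b; simp [M, LinearMap.toMatrix'_mul]
  have hχ : ∀ g, χ g = (M g).trace := by
    intro g
    rw [hρ, LinearMap.trace_eq_matrix_trace ℂ (Pi.basisFun ℂ (Fin n))]
    simp [M, LinearMap.toMatrix_eq_toMatrix']
  let P : Matrix (Fin n) (Fin n) ℂ := ∑ x : G, (M x).conjTranspose * M x
  have hP : P.PosDef := by
    have h1 : P = (∑ x ∈ Finset.univ.erase (1 : G), (M x).conjTranspose * M x) + 1 := by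
      rw [Finset.sum_erase_eq_sub (Finset.mem_univ _)]
      simp [P, hM1]
    rw [h1]
    refine Matrix.PosDef.posSemidef_add ?_ Matrix.PosDef.one
    exact Matrix.posSemidef_sum _ (fun x _ => Matrix.posSemidef_conjTranspose_mul_self _)
  have hu : IsUnit P.det := by
    exact hP.det_pos.ne'.isUnit
  have key : (M g).conjTranspose * P * M g = P := by
    simp only [P, Finset.mul_sum, Finset.sum_mul]
    refine Fintype.sum_equiv (Equiv.mulRight g) _ _ (fun x => ?_)
    simp [hMm, Matrix.conjTranspose_mul, Matrix.mul_assoc]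
  have hinv : M g * M g⁻¹ = 1 := by rw [← hMm]; simp [hM1]
  have key2 : (M g).conjTranspose * P = P * M g⁻¹ := by
    calc (M g).conjTranspose * P = ((M g).conjTranspose * P) * (M g * M g⁻¹) := by simp [hinv]
      _ = P * M g⁻¹ := by rw [← Matrix.mul_assoc, key]
  have key3 : M g⁻¹ = P⁻¹ * ((M g).conjTranspose * P) := by
    rw [key2, ← Matrix.mul_assoc, Matrix.nonsing_inv_mul _ hu, Matrix.one_mul]
  rw [hχ, hχ, key3, Matrix.trace_mul_comm, Matrix.mul_assoc, Matrix.mul_nonsing_inv _ hu,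
    Matrix.mul_one, Matrix.trace_conjTranspose]
  rfl

lemma isChar_of_rep {G : Type*} [Group G] [Fintype G] {V : Type*} [AddCommGroup V] [Module ℂ V]
    [FiniteDimensional ℂ V] (ρ : Representation ℂ G V) : IsChar G ρ.character := by
  let e : V ≃ₗ[ℂ] (Fin (finrank ℂ V) → ℂ) := (Module.finBasis ℂ V).equivFun
  refine ⟨finrank ℂ V, (e.conjRingEquiv : End ℂ V →* End ℂ _).comp ρ, fun g => ?_⟩
  simp only [character, MonoidHom.comp_apply]
  exact (LinearMap.trace_conj' (ρ g) e).symm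

lemma isIrrChar_of_rep {G : Type*} [Group G] [Fintype G] {V : Type*} [AddCommGroup V] [Module ℂ V]
    [FiniteDimensional ℂ V] (ρ : Representation ℂ G V) [IsIrreducible ρ] :
    IsIrrChar G ρ.character := by
  refine ⟨isChar_of_rep ρ, ?_⟩
  have hne : (Nat.card G : ℂ) ≠ 0 := by simp
  let _ : Invertible (Nat.card G : ℂ) := invertibleOfNonzero hne
  have := char_orthonormal ρ ρ
  rw [if_pos ⟨Representation.Equiv.refl ρ⟩, inv_mul_eq_one₀ hne] at this
  simp_rw [← isChar_inv (isChar_of_rep ρ)]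
  rw [← this]; simp

lemma isIrreducible_of_norm {G : Type*} [Group G] [Fintype G] {V : Type*} [AddCommGroup V]
    [Module ℂ V] [FiniteDimensional ℂ V] (ρ : Representation ℂ G V)
    (h : ∑ g : G, ρ.character g * (starRingEnd ℂ) (ρ.character g) = (Fintype.card G : ℂ)) :
    IsIrreducible ρ := by
  have hne : (Nat.card G : ℂ) ≠ 0 := by simp
  let _ : Invertible (Nat.card G : ℂ) := invertibleOfNonzero hne
  have h2 := card_inv_mul_sum_char_mul_char_eq_finrank ρ ρ
  simp_rw [isChar_inv (isChar_of_rep ρ), h, Nat.card_eq_fintype_card] at h2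
  rw [inv_mul_cancel₀ (by simp)] at h2
  have h3 : finrank ℂ (IntertwiningMap ρ ρ) = 1 := by exact_mod_cast h2.symm
  rw [LinearEquiv.finrank_eq (IntertwiningMap.equivLinearMapAsModule ρ ρ)] at h3
  rw [irreducible_iff_isSimpleModule_asModule]
  have hnt : Nontrivial ρ.asModule := by
    by_contra hc
    rw [not_nontrivial_iff_subsingleton] at hc
    have : finrank ℂ (ρ.asModule →ₗ[MonoidAlgebra ℂ G] ρ.asModule) = 0 :=
      finrank_zero_of_subsingleton
    omega
  rw [isSimpleModule_iff]
  refine ⟨fun p => ?_⟩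
  obtain ⟨q, hq⟩ := exists_isCompl p
  let π := p.subtype ∘ₗ p.projectionOnto q hq
  have hone : (1 : Module.End (MonoidAlgebra ℂ G) ρ.asModule) ≠ 0 := one_ne_zero
  obtain ⟨c, hc⟩ := (finrank_eq_one_iff_of_nonzero' _ hone).1 h3 π
  have hcv : ∀ v, c • v = π v := fun v => by rw [← hc]; rfl
  by_cases hc0 : c = 0
  · left
    rw [eq_bot_iff]
    intro v hv
    have := hcv v
    simp only [hc0, zero_smul, π, LinearMap.comp_apply] at this
    rw [Submodule.projectionOnto_apply_left hq ⟨v, hv⟩] at this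
    simpa using this.symm
  · right
    rw [eq_top_iff]
    intro v _
    have h4 : c • v ∈ p := by rw [hcv]; exact (p.projectionOnto q hq v).2
    have h5 : c • v = π v := hcv v
    have h6 := hcv (π v)
    have h7 : π (π v) = π v := by
      simp only [π, LinearMap.comp_apply, Submodule.subtype_apply]
      rw [Submodule.projectionOnto_apply_left hq]
    rw [h7, ← h5, ← sub_eq_zero, ← smul_sub] at h6
    have h8 := (smul_eq_zero.1 h6).resolve_left hc0
    rw [sub_eq_zero] at h8
    rw [← h8]; exact h4

lemma IsIrrChar.exists_rep {G : Type*} [Group G] [Fintype G] {χ : G → ℂ} (h : IsIrrChar G χ) :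
    ∃ (n : ℕ) (ρ : Representation ℂ G (Fin n → ℂ)), IsIrreducible ρ ∧ χ = ρ.character := by
  obtain ⟨⟨n, ρ, hρ⟩, h2⟩ := h
  have : χ = ρ.character := funext hρ
  subst this
  exact ⟨n, ρ, isIrreducible_of_norm ρ h2, rfl⟩

lemma IsIrrChar.orth {G : Type*} [Group G] [Fintype G] {χ ψ : G → ℂ} (h : IsIrrChar G χ)
    (h' : IsIrrChar G ψ) :
    ∑ g : G, χ g * (starRingEnd ℂ) (ψ g) = if χ = ψ then (Fintype.card G : ℂ) else 0 := by
  split_ifs with heq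
  · subst heq; exact h.2
  · obtain ⟨n, ρ, hρ, rfl⟩ := h.exists_rep
    obtain ⟨m, σ, hσ, rfl⟩ := h'.exists_rep
    have hne : (Nat.card G : ℂ) ≠ 0 := by simp
    let _ : Invertible (Nat.card G : ℂ) := invertibleOfNonzero hne
    have h1 := char_orthonormal ρ σ
    rw [if_neg] at h1
    · simp_rw [← isChar_inv (isChar_of_rep σ)]
      exact (mul_eq_zero.1 h1).resolve_left (inv_ne_zero hne)
    · rintro ⟨e⟩
      exact heq (char_iso e).symm

lemma IsIrrChar.conj {G : Type*} [Group G] [Fintype G] {χ : G → ℂ} (h : IsIrrChar G χ) :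
    IsIrrChar G (fun g => (starRingEnd ℂ) (χ g)) := by
  obtain ⟨n, ρ, hρ, rfl⟩ := h.exists_rep
  refine ⟨?_, ?_⟩
  · have := isChar_of_rep ρ.dual
    convert this using 1
    ext g
    rw [char_dual, isChar_inv (isChar_of_rep ρ)]
  · rw [← h.2]
    refine Finset.sum_congr rfl fun g _ => ?_
    rw [Complex.conj_conj, mul_comm]

lemma IsIrrChar.conjInv {G : Type*} [Group G] [Fintype G] {χ : G → ℂ} (h : IsIrrChar G χ)
    {a b : G} (hab : IsConj a b) : χ a = χ b := by
  obtain ⟨n, ρ, hρ, rfl⟩ := h.exists_rep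
  obtain ⟨c, rfl⟩ := isConj_iff.1 hab
  rw [char_conj]

/-- Schur's lemma, for a linear map commuting with an irreducible representation. -/
lemma schur {G : Type*} [Group G] {V : Type*} [AddCommGroup V]
    [Module ℂ V] [FiniteDimensional ℂ V] (ρ : Representation ℂ G V) [IsIrreducible ρ]
    (T : V →ₗ[ℂ] V) (hT : ∀ g, T * ρ g = ρ g * T) : ∃ c : ℂ, T = c • (1 : V →ₗ[ℂ] V) := by
  obtain ⟨c, hc⟩ := (IsIrreducible.algebraMap_intertwiningMap_bijective_of_isAlgClosed
    (ρ := ρ)).2 (⟨T, hT⟩ : IntertwiningMap ρ ρ)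
  refine ⟨c, ?_⟩
  rw [Algebra.algebraMap_eq_smul_one] at hc
  have := congrArg IntertwiningMap.toLinearMap hc
  exact this.symm

lemma rep_sum_zero {G : Type*} [Group G] [Fintype G] {V : Type*} [AddCommGroup V]
    [Module ℂ V] [FiniteDimensional ℂ V] (ρ : Representation ℂ G V) [IsIrreducible ρ] (f : G → ℂ)
    (hf : ∀ a b, f (b * a * b⁻¹) = f a)
    (h : ∑ g : G, f g * (starRingEnd ℂ) (ρ.character g) = 0) :
    ∑ g : G, f g • ρ g⁻¹ = 0 := by
  obtain ⟨c, hc⟩ := schur ρ (∑ g : G, f g • ρ g⁻¹) (by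
    intro x
    rw [Finset.sum_mul, Finset.mul_sum]
    refine Fintype.sum_equiv (MulAut.conj x⁻¹).toEquiv _ _ (fun a => ?_)
    simp only [MulEquiv.toEquiv_eq_coe, MulEquiv.coe_toEquiv, MulAut.conj_apply, hf]
    rw [smul_mul_assoc, mul_smul_comm, ← map_mul, ← map_mul]
    congr 2
    group)
  have ht := congrArg (LinearMap.trace ℂ V) hc
  have hnt : Nontrivial V := by
    have := IsSimpleModule.nontrivial (MonoidAlgebra ℂ G) ρ.asModule
    exact this
  have hd : (finrank ℂ V : ℂ) ≠ 0 := by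
    exact_mod_cast (finrank_pos (R := ℂ) (M := V)).ne'
  have h0 : LinearMap.trace ℂ V (∑ g : G, f g • ρ g⁻¹) = 0 := by
    rw [map_sum, ← h]
    refine Finset.sum_congr rfl fun g _ => ?_
    rw [← isChar_inv (isChar_of_rep ρ), map_smul]; rfl
  rw [h0, map_smul, LinearMap.trace_one, smul_eq_mul] at ht
  have hc0 := (mul_eq_zero.1 ht.symm).resolve_right hd
  rw [hc, hc0, zero_smul]

lemma ofModule'_irreducible {G : Type*} [Group G]
    (M : Type*) [AddCommGroup M] [Module ℂ M] [Module (MonoidAlgebra ℂ G) M]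
    [IsScalarTower ℂ (MonoidAlgebra ℂ G) M]
    [IsSimpleModule (MonoidAlgebra ℂ G) M] :
    IsIrreducible (ofModule' (k := ℂ) (G := G) M) := by
  have hnt := IsSimpleModule.nontrivial (MonoidAlgebra ℂ G) M
  refine @IsSimpleOrder.mk _ _ _ ⟨⟨⊥, ⊤, ?_⟩⟩ ?_
  · intro hbt
    obtain ⟨v, hv⟩ := exists_ne (0 : M)
    have h1 : v ∈ (⊤ : Subrepresentation (ofModule' (k := ℂ) (G := G) M)).toSubmodule :=
      Submodule.mem_top (R := ℂ) (M := M)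
    rw [← hbt] at h1
    exact hv ((Submodule.mem_bot ℂ).1 h1)
  · intro p
    let P : Submodule (MonoidAlgebra ℂ G) M :=
      { carrier := p.toSubmodule
        add_mem' := fun ha hb => p.toSubmodule.add_mem ha hb
        zero_mem' := p.toSubmodule.zero_mem
        smul_mem' := by
          intro c x hx
          induction c using MonoidAlgebra.induction_on with
          | of g => exact p.apply_mem_toSubmodule g hx
          | add a b ha hb => rw [add_smul]; exact p.toSubmodule.add_mem ha hb
          | smul r a ha => rw [smul_assoc]; exact p.toSubmodule.smul_mem r ha }
    have hmem : ∀ x, x ∈ P ↔ x ∈ p.toSubmodule := fun x => Iff.rfl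
    rcases eq_bot_or_eq_top P with hP | hP
    · left
      apply Subrepresentation.toSubmodule_injective
      ext x
      rw [← hmem, hP, Submodule.mem_bot]
      exact (Submodule.mem_bot ℂ).symm
    · right
      apply Subrepresentation.toSubmodule_injective
      ext x
      rw [← hmem, hP]
      exact ⟨fun _ => Submodule.mem_top (R := ℂ), fun _ => Submodule.mem_top⟩

lemma simple_smul_zero {G : Type*} [Group G] [Fintype G] (f : G → ℂ)
    (hf : ∀ a b, f (b * a * b⁻¹) = f a)
    (h : ∀ χ, IsIrrChar G χ → ∑ g : G, f g * (starRingEnd ℂ) (χ g) = 0)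
    (M : Type*) [AddCommGroup M] [Module ℂ M] [Module (MonoidAlgebra ℂ G) M]
    [IsScalarTower ℂ (MonoidAlgebra ℂ G) M]
    [hs : IsSimpleModule (MonoidAlgebra ℂ G) M] (v : M) :
    (∑ g : G, f g • MonoidAlgebra.of ℂ G g⁻¹) • v = 0 := by
  have hi := ofModule'_irreducible (G := G) M
  by_cases hv : v = 0
  · simp [hv]
  have hfd : FiniteDimensional ℂ M := by
    refine Module.Finite.of_surjective
      ((LinearMap.toSpanSingleton (MonoidAlgebra ℂ G) M v).restrictScalars ℂ) ?_
    exact IsSimpleModule.toSpanSingleton_surjective (MonoidAlgebra ℂ G) hv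
  have h0 := rep_sum_zero (ofModule' (k := ℂ) (G := G) M) f hf (h _ (isIrrChar_of_rep _))
  have h1 := congrArg (fun T => T v) h0
  simp only [LinearMap.sum_apply, LinearMap.smul_apply, LinearMap.zero_apply] at h1
  rw [Finset.sum_smul, ← h1]
  refine Finset.sum_congr rfl fun g _ => ?_
  rw [smul_assoc]
  rfl

lemma completeness {G : Type*} [Group G] [Fintype G] (f : G → ℂ)
    (hf : ∀ a b, f (b * a * b⁻¹) = f a)
    (h : ∀ χ, IsIrrChar G χ → ∑ g : G, f g * (starRingEnd ℂ) (χ g) = 0) : f = 0 := by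
  have ha : (∑ g : G, f g • MonoidAlgebra.of ℂ G g⁻¹) ∈ Ring.jacobson (MonoidAlgebra ℂ G) := by
    unfold Ring.jacobson Module.jacobson
    rw [Submodule.mem_sInf]
    intro m hm
    have hs : IsSimpleModule (MonoidAlgebra ℂ G) (MonoidAlgebra ℂ G ⧸ m) :=
      isSimpleModule_iff_isCoatom.2 hm
    have h2 := simple_smul_zero f hf h (MonoidAlgebra ℂ G ⧸ m)
      (Submodule.Quotient.mk (1 : MonoidAlgebra ℂ G))
    rw [← Submodule.Quotient.mk_smul, smul_eq_mul, mul_one, Submodule.Quotient.mk_eq_zero] at h2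
    exact h2
  rw [IsSemisimpleRing.jacobson_eq_bot, Submodule.mem_bot] at ha
  ext x
  have h4 := congrArg (fun b : MonoidAlgebra ℂ G => b.coeff x⁻¹) ha
  simpa [Finsupp.single_apply] using h4

lemma finite_irr (G : Type*) [Group G] [Fintype G] : Finite {χ : G → ℂ // IsIrrChar G χ} := by
  have hli : LinearIndependent ℂ (fun χ : {χ : G → ℂ // IsIrrChar G χ} => (χ : G → ℂ)) := by
    rw [linearIndependent_iff']
    intro s c hs ψ hψ
    have h1 : ∑ g : G, (∑ χ ∈ s, c χ • (χ : G → ℂ)) g * (starRingEnd ℂ) (ψ.1 g) = 0 := by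
      rw [hs]; simp
    have h2 : ∑ g : G, (∑ χ ∈ s, c χ • (χ : G → ℂ)) g * (starRingEnd ℂ) (ψ.1 g)
        = ∑ χ ∈ s, c χ * ∑ g : G, χ.1 g * (starRingEnd ℂ) (ψ.1 g) := by
      simp only [Finset.sum_apply, Pi.smul_apply, smul_eq_mul, Finset.sum_mul, Finset.mul_sum]
      rw [Finset.sum_comm]
      simp only [mul_assoc]
    rw [h2] at h1
    simp_rw [fun χ : {χ : G → ℂ // IsIrrChar G χ} => χ.2.orth ψ.2] at h1
    simp only [Subtype.coe_inj, mul_ite, mul_zero, Finset.sum_ite_eq', hψ, if_true] at h1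
    exact (mul_eq_zero.1 h1).resolve_right (by simp)
  exact hli.finite

/-- The number of conjugates of `h`. -/
noncomputable def ncl {G : Type*} [Group G] [Fintype G] (h : G) : ℂ :=
  ((Finset.univ.filter (fun x : G => IsConj x h)).card : ℂ)

lemma ncl_ne {G : Type*} [Group G] [Fintype G] (h : G) : ncl h ≠ 0 := by
  unfold ncl
  have : h ∈ Finset.univ.filter (fun x : G => IsConj x h) :=
    Finset.mem_filter.2 ⟨Finset.mem_univ _, IsConj.refl h⟩
  exact_mod_cast (Finset.card_pos.2 ⟨h, this⟩).ne'

lemma ncl_congr {G : Type*} [Group G] [Fintype G] {h k : G} (hk : IsConj h k) : ncl h = ncl k := by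
  unfold ncl
  congr 2
  ext x
  simp only [Finset.mem_filter, Finset.mem_univ, true_and]
  exact ⟨fun a => a.trans hk, fun a => a.trans hk.symm⟩

lemma isConj_inv' {G : Type*} [Group G] {h k : G} : IsConj h⁻¹ k⁻¹ ↔ IsConj h k := by
  simp only [isConj_iff]
  refine exists_congr fun c => ?_
  rw [← inv_inj]
  simp [mul_assoc]

lemma ncl_inv {G : Type*} [Group G] [Fintype G] (h : G) : ncl h⁻¹ = ncl h := by
  unfold ncl
  congr 1
  refine Finset.card_bij (fun x _ => x⁻¹) ?_ ?_ ?_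
  · intro a ha
    simp only [Finset.mem_filter, Finset.mem_univ, true_and] at ha ⊢
    rw [← isConj_inv', inv_inv]; exact ha
  · intro a _ b _ hab; simpa using hab
  · intro b hb
    simp only [Finset.mem_filter, Finset.mem_univ, true_and] at hb ⊢
    exact ⟨b⁻¹, isConj_inv'.2 hb, by simp⟩

lemma column_orth (G : Type*) [Group G] [Fintype G] [Fintype {χ : G → ℂ // IsIrrChar G χ}]
    (g h : G) :
    ∑ χ : {χ : G → ℂ // IsIrrChar G χ}, χ.1 g * (starRingEnd ℂ) (χ.1 h)
      = if IsConj g h then (Fintype.card G : ℂ) / ncl h else 0 := by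
  let F : G → ℂ := fun g => (if IsConj g h then (Fintype.card G : ℂ) else 0) -
    ncl h * ∑ χ : {χ : G → ℂ // IsIrrChar G χ}, χ.1 g * (starRingEnd ℂ) (χ.1 h)
  have hF : F = 0 := by
    apply completeness
    · intro a b
      have hc : IsConj (b * a * b⁻¹) a := (isConj_iff.2 ⟨b, rfl⟩ : IsConj a (b * a * b⁻¹)).symm
      have hiff : IsConj (b * a * b⁻¹) h ↔ IsConj a h :=
        ⟨fun x => hc.symm.trans x, fun x => hc.trans x⟩
      simp only [F, hiff]
      congr 2
      exact Finset.sum_congr rfl fun χ _ => by rw [χ.2.conjInv hc]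
    · intro ψ hψ
      simp only [F, sub_mul, Finset.sum_sub_distrib]
      have h1 : ∑ g : G, (if IsConj g h then (Fintype.card G : ℂ) else 0) * (starRingEnd ℂ) (ψ g)
          = Fintype.card G * ncl h * (starRingEnd ℂ) (ψ h) := by
        simp only [ite_mul, zero_mul]
        rw [← Finset.sum_filter]
        rw [Finset.sum_congr rfl (g := fun _ => Fintype.card G * (starRingEnd ℂ) (ψ h))]
        · rw [Finset.sum_const, nsmul_eq_mul]; unfold ncl; ring
        · intro x hx
          rw [hψ.conjInv (Finset.mem_filter.1 hx).2]
      have h2 : ∑ g : G, (ncl h * ∑ χ : {χ : G → ℂ // IsIrrChar G χ},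
            χ.1 g * (starRingEnd ℂ) (χ.1 h)) * (starRingEnd ℂ) (ψ g)
          = ncl h * ∑ χ : {χ : G → ℂ // IsIrrChar G χ}, (starRingEnd ℂ) (χ.1 h) *
              ∑ g : G, χ.1 g * (starRingEnd ℂ) (ψ g) := by
        simp only [Finset.mul_sum, Finset.sum_mul]
        rw [Finset.sum_comm]
        refine Finset.sum_congr rfl fun _ _ => Finset.sum_congr rfl fun _ _ => ?_
        ring
      rw [h1, h2]
      simp_rw [fun χ : {χ : G → ℂ // IsIrrChar G χ} => χ.2.orth hψ]
      rw [Finset.sum_eq_single ⟨ψ, hψ⟩]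
      · simp; ring
      · intro b _ hb
        rw [if_neg (fun hh => hb (Subtype.ext hh)), mul_zero]
      · simp
  have h3 := congrFun hF g
  simp only [F, Pi.zero_apply, sub_eq_zero] at h3
  have hn := ncl_ne h
  split_ifs at h3 ⊢ with hc
  · field_simp
    rw [h3, mul_comm]
  · exact (mul_eq_zero.1 h3.symm).resolve_left hn

lemma IsIrrChar.central {G : Type*} [Group G] [Fintype G] {χ : G → ℂ} (h : IsIrrChar G χ)
    {z : G} (hzc : z ∈ Subgroup.center G) (hz2 : z ^ 2 = 1) :
    (χ z = -χ 1 ∧ ∀ g, χ (z * g) = -χ g) ∨ (χ z ≠ -χ 1 ∧ ∀ g, χ (z * g) = χ g) := by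
  obtain ⟨n, ρ, hρ, rfl⟩ := h.exists_rep
  obtain ⟨c, hc⟩ := schur ρ (ρ z) (fun g => by
    rw [← map_mul, ← map_mul, (Subgroup.mem_center_iff.1 hzc g)])
  have hnt : Nontrivial (Fin n → ℂ) := by
    have := IsSimpleModule.nontrivial (MonoidAlgebra ℂ G) ρ.asModule
    exact this
  have hd : ρ.character 1 ≠ 0 := by
    rw [char_one]
    exact_mod_cast (finrank_pos (R := ℂ) (M := Fin n → ℂ)).ne'
  have hall : ∀ g, ρ.character (z * g) = c * ρ.character g := by
    intro g
    simp only [character]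
    rw [map_mul, hc, smul_mul_assoc, one_mul, map_smul, smul_eq_mul]
  have hcc : c * c = 1 := by
    have h1 := hall z
    have h2 := hall 1
    rw [mul_one] at h2
    rw [← pow_two, hz2, h2, ← mul_assoc] at h1
    exact mul_right_cancel₀ hd (by rw [← h1, one_mul])
  have hz := hall 1
  rw [mul_one] at hz
  rcases mul_self_eq_one_iff.1 hcc with h1 | h1
  · right
    refine ⟨?_, fun g => by rw [hall, h1, one_mul]⟩
    rw [hz, h1, one_mul]
    intro hh
    exact hd (self_eq_neg.1 hh)
  · left
    exact ⟨by rw [hz, h1]; ring, fun g => by rw [hall, h1]; ring⟩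

/-- the weight function -/
noncomputable def wt {G : Type*} [Group G] [Fintype G] (z g : G) : ℂ :=
  ((if IsConj g g⁻¹ then 1 else 0) - (if IsConj (z * g) g⁻¹ then 1 else 0)) / ncl g

lemma count_real {G : Type*} [Group G] [Fintype G] {z : G} (hzc : z ∈ Subgroup.center G)
    (hz2 : z ^ 2 = 1) :
    2 * (Nat.card {χ : G → ℂ // IsIrrChar G χ ∧ IsRealChar G χ ∧ χ z = -χ 1} : ℂ)
      = ∑ g : G, wt z g := by
  have := finite_irr G
  let _ : Fintype {χ : G → ℂ // IsIrrChar G χ} := Fintype.ofFinite _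
  have hcard : (Nat.card {χ : G → ℂ // IsIrrChar G χ ∧ IsRealChar G χ ∧ χ z = -χ 1} : ℂ)
      = ∑ χ : {χ : G → ℂ // IsIrrChar G χ},
        if IsRealChar G χ.1 ∧ χ.1 z = -χ.1 1 then (1 : ℂ) else 0 := by
    rw [Finset.sum_boole, ← Fintype.card_subtype, ← Nat.card_eq_fintype_card]
    congr 1
    exact Nat.card_congr (Equiv.subtypeSubtypeEquivSubtypeInter _ _).symm
  have hne : (Fintype.card G : ℂ) ≠ 0 := by simp
  have hχ : ∀ χ : {χ : G → ℂ // IsIrrChar G χ},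
      ∑ g : G, χ.1 g * (χ.1 g - χ.1 (z * g)) = 2 * Fintype.card G *
        if IsRealChar G χ.1 ∧ χ.1 z = -χ.1 1 then (1 : ℂ) else 0 := by
    intro χ
    rcases χ.2.central hzc hz2 with ⟨h1, h2⟩ | ⟨h1, h2⟩
    · have := χ.2.orth χ.2.conj
      simp only [Complex.conj_conj] at this
      simp only [h2, sub_neg_eq_add, ← two_mul, mul_left_comm _ (2 : ℂ), ← Finset.mul_sum, this, h1,
        and_true]
      have hiff : (χ.1 = fun g => (starRingEnd ℂ) (χ.1 g)) ↔ IsRealChar G χ.1 :=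
        ⟨fun h g => (congrFun h g).symm, fun h => funext fun g => (h g).symm⟩
      simp only [hiff]
      split_ifs <;> ring
    · simp [h2, h1]
  have hg : ∀ g : G, ∑ χ : {χ : G → ℂ // IsIrrChar G χ}, χ.1 g * (χ.1 g - χ.1 (z * g))
      = Fintype.card G * wt z g := by
    intro g
    have hinv : ∀ χ : {χ : G → ℂ // IsIrrChar G χ}, χ.1 g = (starRingEnd ℂ) (χ.1 g⁻¹) := by
      intro χ
      rw [isChar_inv χ.2.1, Complex.conj_conj]
    have h1 := column_orth G g g⁻¹
    have h2 := column_orth G (z * g) g⁻¹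
    rw [ncl_inv] at h1 h2
    simp_rw [← hinv] at h1 h2
    simp_rw [mul_sub, Finset.sum_sub_distrib, h1]
    simp_rw [fun χ : {χ : G → ℂ // IsIrrChar G χ} => mul_comm (χ.1 g) (χ.1 (z * g)), h2]
    unfold wt
    split_ifs <;> ring
  have hsum := Finset.sum_comm (s := Finset.univ) (t := Finset.univ)
    (f := fun (χ : {χ : G → ℂ // IsIrrChar G χ}) (g : G) => χ.1 g * (χ.1 g - χ.1 (z * g)))
  simp_rw [hχ, hg, ← Finset.mul_sum, ← hcard] at hsum
  apply mul_left_cancel₀ hne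
  rw [← hsum]; ring

lemma isConj_z {G : Type*} [Group G] {z : G} (hzc : z ∈ Subgroup.center G) {a b : G} :
    IsConj (z * a) (z * b) ↔ IsConj a b := by
  simp only [isConj_iff]
  refine exists_congr fun c => ?_
  have h := Subgroup.mem_center_iff.1 hzc c
  rw [← mul_assoc, h, mul_assoc, mul_assoc, mul_right_inj, ← mul_assoc]

lemma q_eq_iff {G : Type*} [Group G] (Z : Subgroup G) [Z.Normal] (z : G)
    (hZ : Z = Subgroup.zpowers z) (hzc : z ∈ Subgroup.center G) (hz2 : z ^ 2 = 1) (g h : G) :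
    ConjClasses.mk (QuotientGroup.mk g : G ⧸ Z) = ConjClasses.mk (QuotientGroup.mk h : G ⧸ Z) ↔
      IsConj g h ∨ IsConj g (z * h) := by
  have hzz : z * z = 1 := by rw [← pow_two]; exact hz2
  have hzi : z⁻¹ = z := inv_eq_of_mul_eq_one_left hzz
  have hmem : ∀ x, x ∈ Z ↔ x = 1 ∨ x = z := by
    intro x
    rw [hZ, Subgroup.mem_zpowers_iff]
    constructor
    · rintro ⟨k, rfl⟩
      rcases Int.even_or_odd' k with ⟨m, rfl | rfl⟩
      · left; rw [zpow_mul]; norm_cast; rw [hz2]; simp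
      · right; rw [zpow_add, zpow_mul]; norm_cast; rw [hz2]; simp
    · rintro (rfl | rfl)
      · exact ⟨0, by simp⟩
      · exact ⟨1, by simp⟩
  have hq : ∀ a b : G, (QuotientGroup.mk a : G ⧸ Z) = QuotientGroup.mk b ↔ a = b ∨ a = z * b := by
    intro a b
    rw [QuotientGroup.eq, hmem, inv_mul_eq_one, inv_mul_eq_iff_eq_mul,
      Subgroup.mem_center_iff.1 hzc a]
    refine or_congr Iff.rfl ⟨fun h => ?_, fun h => ?_⟩
    · rw [h, ← mul_assoc, hzz, one_mul]
    · rw [h, ← mul_assoc, hzz, one_mul]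
  rw [ConjClasses.mk_eq_mk_iff_isConj, isConj_iff]
  constructor
  · rintro ⟨c, hc⟩
    obtain ⟨c, rfl⟩ := QuotientGroup.mk_surjective c
    have : (QuotientGroup.mk (c * g * c⁻¹) : G ⧸ Z) = QuotientGroup.mk h := hc
    rcases (hq _ _).1 this with h1 | h1
    · exact Or.inl (isConj_iff.2 ⟨c, h1⟩)
    · exact Or.inr (isConj_iff.2 ⟨c, h1⟩)
  · rintro (h1 | h1) <;> obtain ⟨c, hc⟩ := isConj_iff.1 h1
    · exact ⟨QuotientGroup.mk c, (hq (c * g * c⁻¹) h).2 (Or.inl hc)⟩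
    · exact ⟨QuotientGroup.mk c, (hq (c * g * c⁻¹) h).2 (Or.inr hc)⟩

lemma ncl_z {G : Type*} [Group G] [Fintype G] {z : G} (hzc : z ∈ Subgroup.center G)
    (hz2 : z ^ 2 = 1) (h : G) : ncl (z * h) = ncl h := by
  have hzz : z * z = 1 := by rw [← pow_two]; exact hz2
  unfold ncl
  congr 1
  refine Finset.card_bij (fun x _ => z * x) ?_ ?_ ?_
  · intro a ha
    simp only [Finset.mem_filter, Finset.mem_univ, true_and] at ha ⊢
    rw [← isConj_z hzc, ← mul_assoc, hzz, one_mul]; exact ha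
  · intro a _ b _ hab; simpa using hab
  · intro b hb
    refine ⟨z * b, ?_, by rw [← mul_assoc, hzz, one_mul]⟩
    simp only [Finset.mem_filter, Finset.mem_univ, true_and] at hb ⊢
    exact (isConj_z hzc).2 hb

lemma sum_inv_ncl {G : Type*} [Group G] [Fintype G] (h : G) :
    ∑ x ∈ Finset.univ.filter (fun x : G => IsConj x h), (ncl x)⁻¹ = 1 := by
  rw [Finset.sum_congr rfl (g := fun _ => (ncl h)⁻¹)]
  · rw [Finset.sum_const, nsmul_eq_mul]
    exact mul_inv_cancel₀ (ncl_ne h)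
  · intro x hx
    rw [ncl_congr (Finset.mem_filter.1 hx).2]

lemma fiber_sum {G : Type*} [Group G] [Fintype G] (Z : Subgroup G) [Z.Normal] (z : G)
    (hZ : Z = Subgroup.zpowers z) (hzc : z ∈ Subgroup.center G) (hz2 : z ^ 2 = 1)
    (c : ConjClasses (G ⧸ Z)) :
    ∑ g ∈ Finset.univ.filter (fun g : G => ConjClasses.mk (QuotientGroup.mk g : G ⧸ Z) = c),
      wt z g = 2 * (if (∀ x ∈ c.carrier, x⁻¹ ∈ c.carrier) ∧
          (∀ g : G, ConjClasses.mk (QuotientGroup.mk g : G ⧸ Z) = c →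
            ¬ IsConj g (z * g)) then 1 else 0)
        - 4 * (if (∀ x ∈ c.carrier, x⁻¹ ∈ c.carrier) ∧
          (∀ g : G, ConjClasses.mk (QuotientGroup.mk g : G ⧸ Z) = c →
            ¬ IsConj g (z * g)) ∧
          ∃ g : G, ConjClasses.mk (QuotientGroup.mk g : G ⧸ Z) = c ∧
            ¬ IsConj g g⁻¹ then 1 else 0) := by
  have hzz : z * z = 1 := by rw [← pow_two]; exact hz2
  have hzi : z⁻¹ = z := inv_eq_of_mul_eq_one_left hzz
  have hzz' : ∀ a : G, z * (z * a) = a := fun a => by rw [← mul_assoc, hzz, one_mul]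
  have hzinv : ∀ a : G, (z * a)⁻¹ = z * a⁻¹ := fun a => by
    rw [mul_inv_rev, hzi, Subgroup.mem_center_iff.1 hzc]
  have hZ1 : ∀ a b : G, IsConj (z * a) b ↔ IsConj a (z * b) := fun a b => by
    rw [← isConj_z hzc, hzz']
  have hqq := q_eq_iff Z z hZ hzc hz2
  -- choose a representative
  obtain ⟨g₀, hg₀⟩ : ∃ g₀ : G, ConjClasses.mk (QuotientGroup.mk g₀ : G ⧸ Z) = c := by
    obtain ⟨y, rfl⟩ := ConjClasses.exists_rep c
    obtain ⟨g, rfl⟩ := QuotientGroup.mk_surjective y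
    exact ⟨g, rfl⟩
  subst hg₀
  -- reality of the class in the quotient
  have hreal : (∀ x ∈ (ConjClasses.mk (QuotientGroup.mk g₀ : G ⧸ Z)).carrier,
      x⁻¹ ∈ (ConjClasses.mk (QuotientGroup.mk g₀ : G ⧸ Z)).carrier) ↔
      (IsConj g₀ g₀⁻¹ ∨ IsConj (z * g₀) g₀⁻¹) := by
    rw [hZ1, ← hqq]
    simp only [ConjClasses.mem_carrier_iff_mk_eq]
    constructor
    · intro h
      exact (h _ rfl).symm
    · intro h x hx
      rw [h, QuotientGroup.mk_inv, ConjClasses.mk_eq_mk_iff_isConj, isConj_inv',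
        ← ConjClasses.mk_eq_mk_iff_isConj, hx]
  -- conditions transported to the representative
  have hsplit : (∀ g : G, ConjClasses.mk (QuotientGroup.mk g : G ⧸ Z) =
      ConjClasses.mk (QuotientGroup.mk g₀ : G ⧸ Z) → ¬ IsConj g (z * g)) ↔
      ¬ IsConj g₀ (z * g₀) := by
    constructor
    · intro h; exact h _ rfl
    · intro h g hg hc
      apply h
      rcases (hqq _ _).1 hg with h1 | h1
      · exact h1.symm.trans (hc.trans ((isConj_z hzc).2 h1))
      · have h2 := (isConj_z hzc).2 h1
        rw [hzz'] at h2
        exact ((h1.symm.trans hc).trans h2).symm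
  have hinvc : ∀ g : G, ConjClasses.mk (QuotientGroup.mk g : G ⧸ Z) =
      ConjClasses.mk (QuotientGroup.mk g₀ : G ⧸ Z) →
      ((IsConj g g⁻¹ ↔ IsConj g₀ g₀⁻¹) ∧ (IsConj (z * g) g⁻¹ ↔ IsConj (z * g₀) g₀⁻¹)) := by
    have gen : ∀ a b : G, IsConj a b →
        ((IsConj a a⁻¹ ↔ IsConj b b⁻¹) ∧ (IsConj (z * a) a⁻¹ ↔ IsConj (z * b) b⁻¹)) := by
      intro a b hab
      have hi := isConj_inv'.2 hab
      have hz := (isConj_z hzc).2 hab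
      exact ⟨⟨fun h => hab.symm.trans (h.trans hi), fun h => hab.trans (h.trans hi.symm)⟩,
        ⟨fun h => hz.symm.trans (h.trans hi), fun h => hz.trans (h.trans hi.symm)⟩⟩
    intro g hg
    rcases (hqq _ _).1 hg with h1 | h1
    · exact gen _ _ h1
    · have := gen _ _ h1
      rw [hzinv, isConj_z hzc, isConj_z hzc] at this
      exact this
  have hnr : (∃ g : G, ConjClasses.mk (QuotientGroup.mk g : G ⧸ Z) =
      ConjClasses.mk (QuotientGroup.mk g₀ : G ⧸ Z) ∧ ¬ IsConj g g⁻¹) ↔ ¬ IsConj g₀ g₀⁻¹ := by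
    constructor
    · rintro ⟨g, hg, h⟩
      rwa [(hinvc g hg).1] at h
    · intro h; exact ⟨g₀, rfl, h⟩
  simp only [hreal, hsplit, hnr]
  set w : ℂ := (if IsConj g₀ g₀⁻¹ then 1 else 0) - (if IsConj (z * g₀) g₀⁻¹ then 1 else 0) with hw
  have hsum1 : ∑ g ∈ Finset.univ.filter (fun g : G => ConjClasses.mk (QuotientGroup.mk g : G ⧸ Z) =
      ConjClasses.mk (QuotientGroup.mk g₀ : G ⧸ Z)), wt z g =
      w * ∑ g ∈ Finset.univ.filter (fun g : G => ConjClasses.mk (QuotientGroup.mk g : G ⧸ Z) =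
      ConjClasses.mk (QuotientGroup.mk g₀ : G ⧸ Z)), (ncl g)⁻¹ := by
    rw [Finset.mul_sum]
    refine Finset.sum_congr rfl fun g hg => ?_
    have := hinvc g (Finset.mem_filter.1 hg).2
    simp only [wt, this.1, this.2, hw, div_eq_mul_inv]
  rw [hsum1]
  by_cases hs : IsConj g₀ (z * g₀)
  · have : w = 0 := by
      have hiff : IsConj g₀ g₀⁻¹ ↔ IsConj (z * g₀) g₀⁻¹ :=
        ⟨fun h => hs.symm.trans h, fun h => hs.trans h⟩
      simp only [hw, hiff, sub_self]
    simp [this, hs, -isConj_iff]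
  · have hsum2 : ∑ g ∈ Finset.univ.filter
        (fun g : G => ConjClasses.mk (QuotientGroup.mk g : G ⧸ Z) =
        ConjClasses.mk (QuotientGroup.mk g₀ : G ⧸ Z)), (ncl g)⁻¹ = 2 := by
      simp_rw [hqq]
      rw [Finset.filter_or, Finset.sum_union, sum_inv_ncl, sum_inv_ncl]
      · norm_num
      · rw [Finset.disjoint_left]
        intro x hx hx'
        exact hs ((Finset.mem_filter.1 hx).2.symm.trans (Finset.mem_filter.1 hx').2)
    rw [hsum2, hw]
    have hnot : ¬ (IsConj g₀ g₀⁻¹ ∧ IsConj (z * g₀) g₀⁻¹) :=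
      fun h => hs (h.1.trans h.2.symm)
    by_cases h1 : IsConj g₀ g₀⁻¹ <;> by_cases h2 : IsConj (z * g₀) g₀⁻¹
    · exact absurd ⟨h1, h2⟩ hnot
    all_goals simp only [h1, h2, hs]
    all_goals norm_num

end Helpers

/-- the number of real irreducible characters of `G` over the nontrivial
character of a central subgroup `Z = ⟨z⟩` of order 2 equals the number of real splitting
classes of `G/Z` minus twice the number of real splitting classes of `G/Z` which are
images of non-real classes of `G`. -/
theorem stmt18 {G : Type*} [Group G] [Fintype G] (Z : Subgroup G) [Z.Normal] (z : G)
    (hZ : Z = Subgroup.zpowers z) (hzc : z ∈ Subgroup.center G)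
    (hz1 : z ≠ 1) (hz2 : z ^ 2 = 1) :
    (Nat.card {χ : G → ℂ // IsIrrChar G χ ∧ IsRealChar G χ ∧ χ z = -χ 1} : ℤ) =
      (Nat.card {c : ConjClasses (G ⧸ Z) //
          (∀ x ∈ c.carrier, x⁻¹ ∈ c.carrier) ∧
          (∀ g : G, ConjClasses.mk (QuotientGroup.mk g : G ⧸ Z) = c →
            ¬ IsConj g (z * g))} : ℤ)
      - 2 * (Nat.card {c : ConjClasses (G ⧸ Z) //
          (∀ x ∈ c.carrier, x⁻¹ ∈ c.carrier) ∧
          (∀ g : G, ConjClasses.mk (QuotientGroup.mk g : G ⧸ Z) = c →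
            ¬ IsConj g (z * g)) ∧
          ∃ g : G, ConjClasses.mk (QuotientGroup.mk g : G ⧸ Z) = c ∧
            ¬ IsConj g g⁻¹} : ℤ) := by
  have hN := count_real hzc hz2
  let _ : Fintype (ConjClasses (G ⧸ Z)) := Fintype.ofFinite _
  rw [← Finset.sum_fiberwise Finset.univ
    (fun g : G => ConjClasses.mk (QuotientGroup.mk g : G ⧸ Z))] at hN
  simp_rw [fiber_sum Z z hZ hzc hz2] at hN
  rw [Finset.sum_sub_distrib, ← Finset.mul_sum, ← Finset.mul_sum, Finset.sum_boole,
    Finset.sum_boole, ← Fintype.card_subtype, ← Fintype.card_subtype,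
    ← Nat.card_eq_fintype_card, ← Nat.card_eq_fintype_card] at hN
  apply Int.cast_injective (α := ℂ)
  push_cast
  linear_combination hN / 2
end

section
/- Let N ⊴ G and let x ∈ G be such that the coset x̄ = Nx has odd order in G/N, and let θ ∈ Irr(N) be real-valued, invariant under conjugation by x, and invariant under C_G(x̄) (the preimage in G of the centralizer of x̄ in G/N). Then θ has a unique real-valued extension θ_x to N⟨x⟩, and θ_x is invariant under every element of C_G(x̄) (i.e. x̄ is good for θ). -/
open scoped Classical

open scoped ComplexOrder in
theorem s19_char_inv {K : Type*} [Group K] [Fintype K] {n : ℕ}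
    (ρ : Representation ℂ K (Fin n → ℂ)) (g : K) :
    ρ.character g⁻¹ = (starRingEnd ℂ) (ρ.character g) := by
  let M : K → Matrix (Fin n) (Fin n) ℂ := fun k => LinearMap.toMatrix' (ρ k)
  have hM : ∀ a b, M (a * b) = M a * M b := fun a b => by
    simp [M, LinearMap.toMatrix'_mul]
  have hM1 : M 1 = 1 := by simp [M]
  have htr : ∀ k, ρ.character k = (M k).trace := fun k => by
    simp only [Representation.character, M]
    rw [← LinearMap.toMatrix_eq_toMatrix', LinearMap.trace_eq_matrix_trace ℂ (Pi.basisFun ℂ (Fin n))]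
  let P : Matrix (Fin n) (Fin n) ℂ := ∑ k, (M k).conjTranspose * M k
  have hP : P.PosDef := by
    have : P = (M 1).conjTranspose * M 1 +
        ∑ k ∈ Finset.univ.erase 1, (M k).conjTranspose * M k := by
      rw [Finset.add_sum_erase _ (fun k => (M k).conjTranspose * M k) (Finset.mem_univ 1)]
    rw [this, hM1]
    refine Matrix.PosDef.add_posSemidef (by simpa using Matrix.PosDef.one) ?_
    exact Matrix.posSemidef_sum _ fun k _ => Matrix.posSemidef_conjTranspose_mul_self _
  have hu : IsUnit P.det := (Matrix.isUnit_iff_isUnit_det _).1 hP.isUnit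
  have hinv : (M g).conjTranspose * P * M g = P := by
    simp only [P, Finset.mul_sum, Finset.sum_mul]
    rw [← Equiv.sum_comp (Equiv.mulRight g) (fun k => (M k).conjTranspose * M k)]
    refine Finset.sum_congr rfl fun k _ => ?_
    simp [hM, Matrix.mul_assoc]
  have h1 : M g * M g⁻¹ = 1 := by rw [← hM, mul_inv_cancel, hM1]
  have h2 : (M g).conjTranspose = P * M g⁻¹ * P⁻¹ := by
    have : (M g).conjTranspose * P = P * M g⁻¹ := by
      calc _ = (M g).conjTranspose * P * (M g * M g⁻¹) := by rw [h1, mul_one]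
        _ = _ := by rw [← mul_assoc, hinv]
    rw [← this, mul_assoc, Matrix.mul_nonsing_inv _ hu, mul_one]
  rw [htr, htr, starRingEnd_apply, ← Matrix.trace_conjTranspose, h2, Matrix.trace_mul_comm,
    ← mul_assoc, Matrix.nonsing_inv_mul _ hu, one_mul]

/-- plain-function version of intertwining -/
theorem s19_scalar {K V W : Type*} [Group K] [AddCommGroup V] [Module ℂ V]
    [AddCommGroup W] [Module ℂ W] (ρ : Representation ℂ K V) (σ : Representation ℂ K W)
    (hfin : Module.finrank ℂ (Representation.IntertwiningMap ρ σ) = 1)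
    (f g : V →ₗ[ℂ] W) (hf : ∀ k v, f (ρ k v) = σ k (f v)) (hg : ∀ k v, g (ρ k v) = σ k (g v))
    (hf0 : f ≠ 0) : ∃ c : ℂ, g = c • f := by
  let F := f.intertwiningMap_of_isIntertwiningMap ρ σ hf
  let G := g.intertwiningMap_of_isIntertwiningMap ρ σ hg
  have hF : F ≠ 0 := by
    intro h
    apply hf0
    ext v
    exact congrArg (fun T : Representation.IntertwiningMap ρ σ => T v) h
  obtain ⟨c, hc⟩ := (finrank_eq_one_iff_of_nonzero' F hF).1 hfin G
  refine ⟨c, ?_⟩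
  ext v
  exact (congrArg (fun T : Representation.IntertwiningMap ρ σ => T v) hc).symm

theorem s19_exists {K V W : Type*} [Group K] [AddCommGroup V] [Module ℂ V]
    [AddCommGroup W] [Module ℂ W] (ρ : Representation ℂ K V) (σ : Representation ℂ K W)
    (hfin : Module.finrank ℂ (Representation.IntertwiningMap ρ σ) ≠ 0) :
    ∃ f : V →ₗ[ℂ] W, f ≠ 0 ∧ ∀ k v, f (ρ k v) = σ k (f v) := by
  by_contra hcon
  push Not at hcon
  apply hfin
  have : Subsingleton (Representation.IntertwiningMap ρ σ) := by
    refine ⟨fun a b => ?_⟩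
    have key : ∀ a : Representation.IntertwiningMap ρ σ, a = 0 := fun a => by
      by_contra h
      obtain ⟨k, v, hkv⟩ := hcon a.toLinearMap (fun h0 => h (Representation.IntertwiningMap.ext h0))
      exact hkv (congrArg (fun T : V →ₗ[ℂ] W => T v) (a.isIntertwining' k))
    rw [key a, key b]
  exact Module.finrank_zero_of_subsingleton

theorem s19_inj {K V W : Type*} [Group K] [Fintype K] [AddCommGroup V] [Module ℂ V]
    [AddCommGroup W] [Module ℂ W] (ρ : Representation ℂ K V) (σ : Representation ℂ K W)
    (hfin : Module.finrank ℂ (Representation.IntertwiningMap ρ ρ) = 1)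
    (f : V →ₗ[ℂ] W) (hf : ∀ k v, f (ρ k v) = σ k (f v)) (hf0 : f ≠ 0) :
    Function.Injective f := by
  rw [← LinearMap.ker_eq_bot]
  by_contra hker
  obtain ⟨w, hw, hw0⟩ := (Submodule.ne_bot_iff _).1 hker
  obtain ⟨p, hp⟩ := Submodule.exists_isCompl (LinearMap.ker f)
  let g : V →ₗ[ℂ] V := (LinearMap.ker f).subtype ∘ₗ Submodule.projectionOnto _ _ hp
  have hg1 : ∀ v, f (g v) = 0 := fun v => (Submodule.projectionOnto _ _ hp v).2
  have hg2 : ∀ v, f v = 0 → g v = v := fun v hv => by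
    have := Submodule.projectionOnto_apply_left hp ⟨v, hv⟩
    exact congrArg Subtype.val this
  let S : V →ₗ[ℂ] V := ∑ k : K, ρ k ∘ₗ g ∘ₗ ρ k⁻¹
  have hSa : ∀ v, S v = ∑ k : K, ρ k (g (ρ k⁻¹ v)) := fun v => by simp [S]
  have hS : ∀ k v, S (ρ k v) = ρ k (S v) := by
    intro k v
    rw [hSa, hSa, map_sum, ← Equiv.sum_comp (Equiv.mulLeft k)]
    refine Finset.sum_congr rfl fun j _ => ?_
    simp only [Equiv.coe_mulLeft, map_mul, mul_inv_rev, Module.End.mul_apply]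
    rw [Representation.inv_self_apply]
  have hid : (LinearMap.id : V →ₗ[ℂ] V) ≠ 0 := fun h => hw0 (by
    simpa using congrArg (fun T : V →ₗ[ℂ] V => T w) h)
  obtain ⟨c, hc⟩ := s19_scalar ρ ρ hfin LinearMap.id S (fun _ _ => rfl) hS hid
  have hSw : S w = (Fintype.card K : ℂ) • w := by
    rw [hSa]
    have : ∀ k ∈ Finset.univ, ρ k (g (ρ k⁻¹ w)) = w := fun k _ => by
      rw [hg2 _ (by rw [hf, LinearMap.mem_ker.1 hw, map_zero]), Representation.self_inv_apply]
    rw [Finset.sum_congr rfl this]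
    simp [Finset.card_univ, Nat.cast_smul_eq_nsmul]
  have hcc : c = (Fintype.card K : ℂ) := by
    rw [hc] at hSw
    exact smul_left_injective ℂ hw0 hSw
  have hc0 : c ≠ 0 := by rw [hcc]; exact_mod_cast Fintype.card_ne_zero
  apply hf0
  ext v
  have h1 : f (S v) = 0 := by
    rw [hSa, map_sum]
    exact Finset.sum_eq_zero fun k _ => by rw [hf, hg1, map_zero]
  rw [hc] at h1
  simpa [hc0] using h1

theorem s19_extend {G A : Type*} [Group G] [Group A] (N : Subgroup G) [N.Normal] (x : G)
    (f : ↥N →* A) (t : A)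
    (hconj : ∀ n : ↥N, t * f n * t⁻¹ = f (MulAut.conjNormal x n))
    (hpow : ∀ h : x ^ orderOf (QuotientGroup.mk x : G ⧸ N) ∈ N,
      t ^ orderOf (QuotientGroup.mk x : G ⧸ N) = f ⟨_, h⟩) :
    ∃ F : ↥(N ⊔ Subgroup.zpowers x) →* A,
      (∀ n : ↥N, F ⟨n, (le_sup_left : N ≤ N ⊔ Subgroup.zpowers x) n.2⟩ = f n) ∧
      F ⟨x, (le_sup_right : _ ≤ N ⊔ Subgroup.zpowers x) (Subgroup.mem_zpowers x)⟩ = t := by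
  have hz : ∀ (i : ℤ) (h : x ^ i ∈ N), t ^ i = f ⟨x ^ i, h⟩ := by
    intro i h
    have hm : x ^ orderOf (QuotientGroup.mk x : G ⧸ N) ∈ N := by
      rw [← QuotientGroup.eq_one_iff, QuotientGroup.mk_pow, pow_orderOf_eq_one]
    have hd : (orderOf (QuotientGroup.mk x : G ⧸ N) : ℤ) ∣ i := by
      rw [orderOf_dvd_iff_zpow_eq_one, ← QuotientGroup.mk_zpow, QuotientGroup.eq_one_iff]
      exact h
    obtain ⟨k, rfl⟩ := hd
    rw [zpow_mul, zpow_natCast, hpow hm, ← map_zpow]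
    congr 1
    ext
    simp [zpow_mul]
  have hconjz : ∀ (i : ℤ) (n : ↥N), t ^ i * f n * (t ^ i)⁻¹ = f (MulAut.conjNormal (x ^ i) n) := by
    intro i
    induction i using Int.induction_on with
    | zero => intro n; simp
    | succ i ih =>
      intro n
      rw [zpow_add_one, zpow_add_one, map_mul, MulAut.mul_apply, ← ih, ← hconj]
      group
    | pred i ih =>
      intro n
      rw [zpow_sub_one, zpow_sub_one, map_mul, MulAut.mul_apply, ← ih]
      have := hconj (MulAut.conjNormal x⁻¹ n)
      rw [← MulAut.mul_apply, ← map_mul, mul_inv_cancel, map_one, MulAut.one_apply] at this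
      rw [← this]
      group
  have hwd : ∀ (n n' : ↥N) (i j : ℤ), (n : G) * x ^ i = n' * x ^ j → f n * t ^ i = f n' * t ^ j := by
    intro n n' i j h
    have h1 : x ^ (i - j) = ((n⁻¹ * n' : ↥N) : G) := by
      rw [zpow_sub]
      push_cast
      have : x ^ i = (n : G)⁻¹ * (n' * x ^ j) := by rw [← h]; group
      rw [this]; group
    have h2 : x ^ (i - j) ∈ N := h1 ▸ (n⁻¹ * n').2
    have h3 := hz _ h2
    have h4 : (⟨x ^ (i - j), h2⟩ : ↥N) = n⁻¹ * n' := Subtype.ext h1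
    rw [h4, map_mul, map_inv, zpow_sub] at h3
    have h5 : t ^ i = (f n)⁻¹ * f n' * t ^ j := by rw [← h3]; group
    rw [h5]; group
  have hex : ∀ h : ↥(N ⊔ Subgroup.zpowers x), ∃ (n : ↥N) (i : ℤ), (h : G) = n * x ^ i := by
    rintro ⟨h, hh⟩
    obtain ⟨n, hn, z, hz, rfl⟩ := Subgroup.mem_sup_of_normal_left.1 hh
    obtain ⟨i, rfl⟩ := Subgroup.mem_zpowers_iff.1 hz
    exact ⟨⟨n, hn⟩, i, rfl⟩
  choose a b hab using hex
  have hval : ∀ (h : ↥(N ⊔ Subgroup.zpowers x)) (n : ↥N) (i : ℤ), (h : G) = n * x ^ i → f (a h) * t ^ b h = f n * t ^ i :=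
    fun h n i e => hwd _ _ _ _ ((hab h).symm.trans e)
  refine ⟨MonoidHom.mk' (fun h => f (a h) * t ^ b h) ?_, ?_, ?_⟩
  · intro h k
    have e : ((h * k : ↥(N ⊔ Subgroup.zpowers x)) : G) =
        ((a h * MulAut.conjNormal (x ^ b h) (a k) : ↥N) : G) * x ^ (b h + b k) := by
      push_cast
      have e1 := hab h
      have e2 := hab k
      generalize a h = ah at *
      generalize b h = bh at *
      generalize a k = ak at *
      generalize b k = bk at *
      rw [e1, e2, MulAut.conjNormal_apply, zpow_add]
      group
    rw [hval _ _ _ e, map_mul, ← hconjz, zpow_add]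
    group
  · intro n
    simpa using hval ⟨n, (le_sup_left : N ≤ N ⊔ Subgroup.zpowers x) n.2⟩ n 0 (by simp)
  · simpa using hval ⟨x, (le_sup_right : _ ≤ N ⊔ Subgroup.zpowers x) (Subgroup.mem_zpowers x)⟩ 1 1
      (by simp)

theorem s19_finrank {K V W : Type*} [Group K] [Fintype K] [AddCommGroup V] [Module ℂ V]
    [AddCommGroup W] [Module ℂ W] [FiniteDimensional ℂ V] [FiniteDimensional ℂ W]
    (ρ : Representation ℂ K V) (σ : Representation ℂ K W)
    (h : ∑ g : K, σ.character g * ρ.character g⁻¹ = (Fintype.card K : ℂ)) :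
    Module.finrank ℂ (Representation.IntertwiningMap ρ σ) = 1 := by
  have h0 : (Nat.card K : ℂ) ≠ 0 := by exact_mod_cast Nat.card_pos.ne'
  have := invertibleOfNonzero h0
  have := Representation.card_inv_mul_sum_char_mul_char_eq_finrank ρ σ
  rw [h, ← Nat.card_eq_fintype_card, inv_mul_cancel₀ h0] at this
  exact_mod_cast this.symm
theorem s19_induct {G : Type*} [Group G] (N : Subgroup G) (x : G)
    (S : Subgroup ↥(N ⊔ Subgroup.zpowers x))
    (h1 : ∀ n : ↥N, Subgroup.inclusion (le_sup_left : N ≤ N ⊔ Subgroup.zpowers x) n ∈ S)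
    (h2 : (⟨x, (le_sup_right : _ ≤ N ⊔ Subgroup.zpowers x) (Subgroup.mem_zpowers x)⟩ :
      ↥(N ⊔ Subgroup.zpowers x)) ∈ S) (h : ↥(N ⊔ Subgroup.zpowers x)) : h ∈ S := by
  have : N ⊔ Subgroup.zpowers x ≤ S.map (Subgroup.subtype _) := by
    refine sup_le (fun n hn => ?_) ?_
    · exact ⟨_, h1 ⟨n, hn⟩, rfl⟩
    · rw [Subgroup.zpowers_le]
      exact ⟨_, h2, rfl⟩
  obtain ⟨y, hy, hyh⟩ := this h.2
  have : y = h := Subtype.ext hyh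
  exact this ▸ hy

/-- the elements preserving a bilinear form -/
def s19_stab {K V : Type*} [Group K] [AddCommGroup V] [Module ℂ V] (σ : Representation ℂ K V)
    (B : V →ₗ[ℂ] Module.Dual ℂ V) : Subgroup K where
  carrier := {k | ∀ v w, B (σ k v) (σ k w) = B v w}
  one_mem' := by simp
  mul_mem' := by
    intro a b ha hb v w
    simp only [map_mul, Module.End.mul_apply]
    rw [ha, hb]
  inv_mem' := by
    intro a ha v w
    rw [← ha]
    simp

theorem s19_odd {l : ℂ} {m : ℕ} (hm : Odd m) (h1 : l ^ m = 1) (h2 : l ^ 2 = 1) : l = 1 := by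
  obtain ⟨k, rfl⟩ := hm
  rw [pow_succ, pow_mul, h2, one_pow, one_mul] at h1
  exact h1

theorem s19_pow_mem {G : Type*} [Group G] (N : Subgroup G) [N.Normal] (x : G) :
    x ^ orderOf (QuotientGroup.mk x : G ⧸ N) ∈ N := by
  rw [← QuotientGroup.eq_one_iff, QuotientGroup.mk_pow, pow_orderOf_eq_one]

/-- existence of the real extension -/
theorem s19_existence {G : Type*} [Group G] [Fintype G] (N : Subgroup G) [N.Normal] (x : G)
    (hodd : Odd (orderOf (QuotientGroup.mk x : G ⧸ N))) {n : ℕ}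
    (ρ : Representation ℂ ↥N (Fin n → ℂ))
    (hn : ∑ g : ↥N, ρ.character g * (starRingEnd ℂ) (ρ.character g) = (Fintype.card ↥N : ℂ))
    (hreal : ∀ g, (starRingEnd ℂ) (ρ.character g) = ρ.character g)
    (hx : ∀ g, ρ.character (MulAut.conjNormal x g) = ρ.character g) :
    ∃ σ : Representation ℂ ↥(N ⊔ Subgroup.zpowers x) (Fin n → ℂ),
      (∀ g : ↥N, σ (Subgroup.inclusion le_sup_left g) = ρ g) ∧
      ∀ h, (starRingEnd ℂ) (σ.character h) = σ.character h := by
  set m := orderOf (QuotientGroup.mk x : G ⧸ N) with hmdef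
  have hxm : x ^ m ∈ N := s19_pow_mem N x
  have hend : Module.finrank ℂ (Representation.IntertwiningMap ρ ρ) = 1 :=
    s19_finrank _ _ (by simpa only [s19_char_inv] using hn)
  let ρx : Representation ℂ ↥N (Fin n → ℂ) := ρ.comp (MulAut.conjNormal x).toMonoidHom
  have hρx : ∀ g, ρx g = ρ (MulAut.conjNormal x g) := fun _ => rfl
  have hendx : Module.finrank ℂ (Representation.IntertwiningMap ρ ρx) = 1 := by
    refine s19_finrank _ _ ?_
    have : ∀ g, ρx.character g = ρ.character g := hx
    simpa only [s19_char_inv, this] using hn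
  have hdual : Module.finrank ℂ (Representation.IntertwiningMap ρ ρ.dual) = 1 := by
    refine s19_finrank _ _ ?_
    simp only [Representation.char_dual, s19_char_inv]
    simpa only [hreal] using hn
  obtain ⟨T, hT0, hT⟩ := s19_exists ρ ρx (by omega)
  have hTinj := s19_inj ρ ρx hend T hT hT0
  obtain ⟨B, hB0, hB⟩ := s19_exists ρ ρ.dual (by omega)
  have hBinj := s19_inj ρ ρ.dual hend B hB hB0
  have hBinv : ∀ g v w, B (ρ g v) (ρ g w) = B v w := by
    intro g v w
    rw [hB, Representation.dual_apply]
    simp [Module.Dual.transpose_apply]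
  have hTu : IsUnit T := by
    rw [Module.End.isUnit_iff]
    exact ⟨hTinj, LinearMap.injective_iff_surjective.1 hTinj⟩
  have hid : (1 : Module.End ℂ (Fin n → ℂ)) ≠ 0 := by
    intro h
    apply hT0
    rw [← mul_one T, h, mul_zero]
  have hTpow : ∀ (k : ℕ) (g : ↥N), T ^ k * ρ g = ρ (MulAut.conjNormal (x ^ k) g) * T ^ k := by
    intro k
    induction k with
    | zero => intro g; simp
    | succ k ih =>
      intro g
      have h1 : T * ρ g = ρ (MulAut.conjNormal x g) * T := LinearMap.ext (hT g)
      rw [pow_succ, mul_assoc, h1, ← mul_assoc, ih, pow_succ, map_mul, MulAut.mul_apply, mul_assoc]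
  obtain ⟨c, hc⟩ : ∃ c : ℂ, T ^ m = c • ρ ⟨x ^ m, hxm⟩ := by
    let S : Module.End ℂ (Fin n → ℂ) := ρ (⟨x ^ m, hxm⟩⁻¹) * T ^ m
    have hS : ∀ g, S * ρ g = ρ g * S := by
      intro g
      simp only [S]
      rw [mul_assoc, hTpow, ← mul_assoc, ← mul_assoc, ← map_mul, ← map_mul]
      congr 2
      ext
      rw [Subgroup.coe_mul, Subgroup.coe_mul, MulAut.conjNormal_apply]
      push_cast
      group
    obtain ⟨c, hc⟩ := s19_scalar ρ ρ hend 1 S (fun _ _ => rfl)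
      (fun k v => congrArg (fun T : Module.End ℂ (Fin n → ℂ) => T v) (hS k)) hid
    refine ⟨c, ?_⟩
    have : T ^ m = ρ ⟨x ^ m, hxm⟩ * S := by
      simp only [S]
      rw [← mul_assoc, ← map_mul, mul_inv_cancel, map_one, one_mul]
    rw [this, hc, mul_smul_comm, mul_one]
  have hc0 : c ≠ 0 := by
    rintro rfl
    rw [zero_smul] at hc
    have hu := hTu.pow m
    rw [hc] at hu
    obtain ⟨u, hu⟩ := hu
    apply hid
    rw [← Units.mul_inv u, hu, zero_mul]
  obtain ⟨d, hd⟩ := IsAlgClosed.exists_pow_nat_eq c hodd.pos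
  have hd0 : d ≠ 0 := by
    rintro rfl
    rw [zero_pow hodd.pos.ne'] at hd
    exact hc0 hd.symm
  obtain ⟨μ, hμ⟩ : ∃ μ : ℂ, ∀ v w, B ((d⁻¹ • T) v) ((d⁻¹ • T) w) = μ * B v w := by
    let B' : (Fin n → ℂ) →ₗ[ℂ] Module.Dual ℂ (Fin n → ℂ) :=
      LinearMap.compl₁₂ B (d⁻¹ • T) (d⁻¹ • T)
    have hB' : ∀ k v, B' (ρ k v) = ρ.dual k (B' v) := by
      intro k v
      refine LinearMap.ext fun w => ?_
      rw [Representation.dual_apply]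
      simp only [B', Module.Dual.transpose_apply, LinearMap.compl₁₂_apply, LinearMap.smul_apply,
        LinearMap.comp_apply]
      have h1 : w = ρ k (ρ k⁻¹ w) := by simp
      conv_lhs => rw [h1]
      rw [hT, hT, hρx]
      simp only [map_smul, LinearMap.smul_apply]
      rw [hBinv]
    obtain ⟨μ, hμ⟩ := s19_scalar ρ ρ.dual hdual B B' hB hB' hB0
    refine ⟨μ, fun v w => ?_⟩
    have := congrArg (fun T : (Fin n → ℂ) →ₗ[ℂ] Module.Dual ℂ (Fin n → ℂ) => T v w) hμ
    simpa only [B', LinearMap.compl₁₂_apply, LinearMap.smul_apply, smul_eq_mul] using this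
  have hBpow : ∀ (k : ℕ) v w, B (((d⁻¹ • T) ^ k) v) (((d⁻¹ • T) ^ k) w) = μ ^ k * B v w := by
    intro k
    induction k with
    | zero => intro v w; simp
    | succ k ih =>
      intro v w
      rw [pow_succ, Module.End.mul_apply, Module.End.mul_apply, ih, hμ]
      ring
  have hT1 : (d⁻¹ • T) ^ m = ρ ⟨x ^ m, hxm⟩ := by
    rw [smul_pow, hc, inv_pow, hd, smul_smul, inv_mul_cancel₀ hc0, one_smul]
  have hμm : μ ^ m = 1 := by
    obtain ⟨v, w, hvw⟩ : ∃ v w, B v w ≠ 0 := by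
      by_contra hcon
      push Not at hcon
      exact hB0 (LinearMap.ext fun v => LinearMap.ext fun w => hcon v w)
    have := hBpow m v w
    rw [hT1, hBinv] at this
    exact (mul_right_cancel₀ hvw (by rw [one_mul]; exact this)).symm
  have hμ0 : μ ≠ 0 := by
    rintro rfl
    rw [zero_pow hodd.pos.ne'] at hμm
    exact zero_ne_one hμm
  obtain ⟨j, hj⟩ := id hodd
  let ν : ℂ := μ ^ j
  have hν2 : ν * ν * μ = 1 := by
    rw [← hμm, hj]; simp only [ν]; ring
  have hνm : ν ^ m = 1 := by
    simp only [ν]; rw [← pow_mul, mul_comm, pow_mul, hμm, one_pow]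
  have hν0 : ν ≠ 0 := pow_ne_zero _ hμ0
  let t' : Module.End ℂ (Fin n → ℂ) := ν • (d⁻¹ • T)
  have ht'u : IsUnit t' := by
    have e : t' = (Units.mk0 (ν * d⁻¹) (mul_ne_zero hν0 (inv_ne_zero hd0))) • T := by
      simp only [t', smul_smul, Units.smul_def, Units.val_mk0]
    rw [e]
    exact hTu.smul _
  obtain ⟨t, ht⟩ := ht'u
  let f : ↥N →* (Module.End ℂ (Fin n → ℂ))ˣ := MonoidHom.toHomUnits ρ
  have hf : ∀ g, ((f g : (Module.End ℂ (Fin n → ℂ))ˣ) : Module.End ℂ (Fin n → ℂ)) = ρ g :=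
    fun _ => rfl
  obtain ⟨F, hF1, hF2⟩ := s19_extend N x f t
    (by
      intro g
      rw [mul_inv_eq_iff_eq_mul]
      ext1
      rw [Units.val_mul, Units.val_mul, hf, hf, ht]
      have h1 : T * ρ g = ρ (MulAut.conjNormal x g) * T := LinearMap.ext (hT g)
      simp only [t', smul_mul_assoc, mul_smul_comm, h1])
    (by
      intro h
      ext1
      rw [Units.val_pow_eq_pow_val, hf, ht]
      change (ν • (d⁻¹ • T)) ^ m = _
      rw [smul_pow, hνm, one_smul, hT1])
  let σ : Representation ℂ ↥(N ⊔ Subgroup.zpowers x) (Fin n → ℂ) := (Units.coeHom _).comp F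
  have hσN : ∀ g : ↥N, σ (Subgroup.inclusion le_sup_left g) = ρ g := by
    intro g
    rw [← hf, ← hF1]
    rfl
  refine ⟨σ, hσN, ?_⟩
  have hstab : ∀ h, h ∈ s19_stab σ B := by
    refine s19_induct N x _ (fun g v w => ?_) (fun v w => ?_)
    · rw [hσN, hBinv]
    · have : σ ⟨x, (le_sup_right : _ ≤ N ⊔ Subgroup.zpowers x) (Subgroup.mem_zpowers x)⟩ = t' := by
        rw [← ht, ← hF2]; rfl
      rw [this]
      have e1 : ∀ u, t' u = ν • ((d⁻¹ • T) u) := fun _ => rfl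
      have h3 := hμ v w
      rw [e1, e1]
      generalize (d⁻¹ • T) v = a at h3
      generalize (d⁻¹ • T) w = b at h3
      rw [map_smul, map_smul, LinearMap.smul_apply, h3, smul_eq_mul, smul_eq_mul]
      linear_combination (B v w) * hν2
  intro h
  rw [← s19_char_inv, ← Representation.char_dual]
  have hBbij : Function.Bijective B :=
    ⟨hBinj, (LinearMap.injective_iff_surjective_of_finrank_eq_finrank
      (Subspace.dual_finrank_eq).symm).1 hBinj⟩
  let e := LinearEquiv.ofBijective B hBbij
  have he : σ.dual h = e.conj (σ h) := by
    refine LinearMap.ext fun φ => ?_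
    obtain ⟨v, rfl⟩ := e.surjective φ
    rw [LinearEquiv.conj_apply_apply, LinearEquiv.symm_apply_apply]
    refine LinearMap.ext fun w => ?_
    have h1 := hstab h v (σ h⁻¹ w)
    rw [Representation.self_inv_apply] at h1
    exact h1.symm
  simp only [Representation.character]
  rw [he, LinearMap.trace_conj']

theorem s19_form {K : Type*} [Group K] [Fintype K] {n : ℕ} (σ : Representation ℂ K (Fin n → ℂ))
    (hreal : ∀ g, (starRingEnd ℂ) (σ.character g) = σ.character g) (hn : n ≠ 0) :
    ∃ B : (Fin n → ℂ) →ₗ[ℂ] Module.Dual ℂ (Fin n → ℂ), B ≠ 0 ∧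
      ∀ g v w, B (σ g v) (σ g w) = B v w := by
  have hne : Module.finrank ℂ (Representation.IntertwiningMap σ σ.dual) ≠ 0 := by
    intro h0
    have hK0 : (Nat.card K : ℂ) ≠ 0 := by exact_mod_cast Nat.card_pos.ne'
    have := invertibleOfNonzero hK0
    have h1 := Representation.card_inv_mul_sum_char_mul_char_eq_finrank σ σ.dual
    rw [h0, Nat.cast_zero, mul_eq_zero, inv_eq_zero, or_iff_right hK0] at h1
    have h2 : ∑ g : K, ‖σ.character g‖ ^ 2 = 0 := by
      rw [← Complex.ofReal_inj]
      push_cast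
      rw [← h1]
      refine Finset.sum_congr rfl fun g _ => ?_
      rw [Representation.char_dual, s19_char_inv, ← Complex.mul_conj', hreal]
    rw [Finset.sum_eq_zero_iff_of_nonneg (fun _ _ => by positivity)] at h2
    have h3 := h2 1 (Finset.mem_univ _)
    simp [hn] at h3
  obtain ⟨B, hB0, hB⟩ := s19_exists σ σ.dual hne
  refine ⟨B, hB0, fun g v w => ?_⟩
  rw [hB, Representation.dual_apply]
  simp [Module.Dual.transpose_apply]

theorem s19_unique {G : Type*} [Group G] [Fintype G] (N : Subgroup G) [N.Normal] (x : G)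
    (hodd : Odd (orderOf (QuotientGroup.mk x : G ⧸ N))) {n n' : ℕ}
    (θ : ↥N → ℂ) (hn : ∑ g : ↥N, θ g * (starRingEnd ℂ) (θ g) = (Fintype.card ↥N : ℂ))
    (hθ : ∀ g, (starRingEnd ℂ) (θ g) = θ g)
    (σ : Representation ℂ ↥(N ⊔ Subgroup.zpowers x) (Fin n → ℂ))
    (σ' : Representation ℂ ↥(N ⊔ Subgroup.zpowers x) (Fin n' → ℂ))
    (h1 : ∀ g : ↥N, σ.character (Subgroup.inclusion le_sup_left g) = θ g)
    (h1' : ∀ g : ↥N, σ'.character (Subgroup.inclusion le_sup_left g) = θ g)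
    (h2 : ∀ h, (starRingEnd ℂ) (σ.character h) = σ.character h)
    (h2' : ∀ h, (starRingEnd ℂ) (σ'.character h) = σ'.character h) :
    σ.character = σ'.character := by
  set m := orderOf (QuotientGroup.mk x : G ⧸ N) with hmdef
  have hxm : x ^ m ∈ N := s19_pow_mem N x
  let i : ↥N →* ↥(N ⊔ Subgroup.zpowers x) := Subgroup.inclusion le_sup_left
  let X : ↥(N ⊔ Subgroup.zpowers x) :=
    ⟨x, (le_sup_right : _ ≤ N ⊔ Subgroup.zpowers x) (Subgroup.mem_zpowers x)⟩
  let τ : Representation ℂ ↥N (Fin n → ℂ) := σ.comp i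
  let τ' : Representation ℂ ↥N (Fin n' → ℂ) := σ'.comp i
  have hτa : ∀ g, τ g = σ (i g) := fun _ => rfl
  have hτa' : ∀ g, τ' g = σ' (i g) := fun _ => rfl
  have hτ : ∀ g, τ.character g = θ g := h1
  have hτ' : ∀ g, τ'.character g = θ g := h1'
  have hnn : n = n' := by
    have a := hτ 1
    have b := hτ' 1
    rw [Representation.char_one] at a b
    have := a.trans b.symm
    simpa using this
  have hend : Module.finrank ℂ (Representation.IntertwiningMap τ τ) = 1 :=
    s19_finrank _ _ (by simp only [s19_char_inv]; simpa only [hτ] using hn)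
  have hhom : Module.finrank ℂ (Representation.IntertwiningMap τ τ') = 1 :=
    s19_finrank _ _ (by simp only [s19_char_inv]; simpa only [hτ, hτ'] using hn)
  have hdual : Module.finrank ℂ (Representation.IntertwiningMap τ τ.dual) = 1 := by
    refine s19_finrank _ _ ?_
    simp only [Representation.char_dual, s19_char_inv]
    simpa only [hτ, hθ] using hn
  obtain ⟨φ, hφ0, hφ⟩ := s19_exists τ τ' (by omega)
  have hφinj := s19_inj τ τ' hend φ hφ hφ0
  have hφsurj : Function.Surjective φ :=
    (LinearMap.injective_iff_surjective_of_finrank_eq_finrank (by simp [hnn])).1 hφinj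
  have hn0 : n ≠ 0 := by
    rintro rfl
    exact hφ0 (Subsingleton.elim _ _)
  obtain ⟨B, hB0, hB⟩ := s19_form σ h2 hn0
  obtain ⟨B', hB0', hB'⟩ := s19_form σ' h2' (hnn ▸ hn0)
  obtain ⟨l, hl⟩ : ∃ l : ℂ, ∀ v, σ' X (φ v) = l • φ (σ X v) := by
    let φ' : (Fin n → ℂ) →ₗ[ℂ] (Fin n' → ℂ) := σ' X ∘ₗ φ ∘ₗ σ X⁻¹
    have hφ' : ∀ k v, φ' (τ k v) = τ' k (φ' v) := by
      intro k v
      have e1 : X⁻¹ * i k = i (MulAut.conjNormal x⁻¹ k) * X⁻¹ := by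
        ext; simp [X, i]
      have e2 : X * i (MulAut.conjNormal x⁻¹ k) = i k * X := by
        ext; simp [X, i, mul_assoc]
      simp only [φ', LinearMap.comp_apply]
      rw [hτa, hτa', ← Module.End.mul_apply, ← map_mul, e1, map_mul, Module.End.mul_apply,
        ← hτa, hφ, hτa', ← Module.End.mul_apply, ← Module.End.mul_apply, ← map_mul, e2, map_mul,
        Module.End.mul_apply]
    obtain ⟨l, hl⟩ := s19_scalar τ τ' hhom φ φ' hφ hφ' hφ0
    refine ⟨l, fun v => ?_⟩
    have := congrArg (fun T : (Fin n → ℂ) →ₗ[ℂ] (Fin n' → ℂ) => T (σ X v)) hl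
    simpa [φ'] using this
  have hlpow : ∀ (k : ℕ) v, σ' (X ^ k) (φ v) = l ^ k • φ (σ (X ^ k) v) := by
    intro k
    induction k with
    | zero => intro v; simp
    | succ k ih =>
      intro v
      rw [pow_succ, map_mul, map_mul, Module.End.mul_apply, Module.End.mul_apply, hl, map_smul, ih,
        smul_smul, pow_succ, mul_comm]
  obtain ⟨v0, hv0⟩ : ∃ v, φ v ≠ 0 := by
    by_contra hcon
    push Not at hcon
    exact hφ0 (LinearMap.ext hcon)
  have hlm : l ^ m = 1 := by
    have hX : X ^ m = i ⟨x ^ m, hxm⟩ := by ext; simp [X, i]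
    have h3 := hlpow m (σ (X ^ m)⁻¹ v0)
    rw [Representation.self_inv_apply, hX, ← hτa', ← hφ, hτa, Representation.self_inv_apply] at h3
    have h4 : l ^ m • φ v0 = (1 : ℂ) • φ v0 := by rw [one_smul]; exact h3.symm
    exact smul_left_injective ℂ hv0 h4
  obtain ⟨μ, hμ⟩ : ∃ μ : ℂ, ∀ v w, B' (φ v) (φ w) = μ * B v w := by
    let C : (Fin n → ℂ) →ₗ[ℂ] Module.Dual ℂ (Fin n → ℂ) := LinearMap.compl₁₂ B' φ φ
    have hBt : ∀ k v, B (τ k v) = τ.dual k (B v) := by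
      intro k v
      refine LinearMap.ext fun w => ?_
      have := hB (i k) v (σ (i k)⁻¹ w)
      rw [Representation.self_inv_apply] at this
      exact this
    have hC : ∀ k v, C (τ k v) = τ.dual k (C v) := by
      intro k v
      refine LinearMap.ext fun w => ?_
      have := hB' (i k) (φ v) (φ (τ k⁻¹ w))
      rw [← hτa', ← hφ, ← hφ, Representation.self_inv_apply] at this
      exact this
    obtain ⟨μ, hμ⟩ := s19_scalar τ τ.dual hdual B C hBt hC hB0
    refine ⟨μ, fun v w => ?_⟩
    exact congrArg (fun T : (Fin n → ℂ) →ₗ[ℂ] Module.Dual ℂ (Fin n → ℂ) => T v w) hμ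
  have hl2 : l ^ 2 = 1 := by
    obtain ⟨v, w, hvw⟩ : ∃ v w, B' (φ v) (φ w) ≠ 0 := by
      by_contra hcon
      push Not at hcon
      refine hB0' (LinearMap.ext fun v => LinearMap.ext fun w => ?_)
      obtain ⟨v, rfl⟩ := hφsurj v
      obtain ⟨w, rfl⟩ := hφsurj w
      exact hcon v w
    have h3 := hB' X (φ v) (φ w)
    rw [hl, hl, map_smul, map_smul, LinearMap.smul_apply, hμ, hB, ← hμ, smul_eq_mul,
      smul_eq_mul, ← mul_assoc] at h3
    rw [pow_two]
    exact mul_right_cancel₀ hvw (by rw [one_mul]; exact h3)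
  have hl1 : l = 1 := s19_odd hodd hlm hl2
  let S : Subgroup ↥(N ⊔ Subgroup.zpowers x) :=
    { carrier := {k | ∀ v, σ' k (φ v) = φ (σ k v)}
      one_mem' := by simp
      mul_mem' := by
        intro a b ha hb v
        simp only [map_mul, Module.End.mul_apply]
        rw [hb, ha]
      inv_mem' := by
        intro a ha v
        have := ha (σ a⁻¹ v)
        rw [Representation.self_inv_apply] at this
        rw [← this, Representation.inv_self_apply] }
  have hS : ∀ h, h ∈ S := by
    refine s19_induct N x S (fun g v => ?_) (fun v => ?_)
    · exact (hφ g v).symm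
    · have := hl v
      rw [hl1, one_smul] at this
      exact this
  let e := LinearEquiv.ofBijective φ ⟨hφinj, hφsurj⟩
  funext h
  have he : σ' h = e.conj (σ h) := by
    refine LinearMap.ext fun w => ?_
    obtain ⟨v, rfl⟩ := e.surjective w
    rw [LinearEquiv.conj_apply_apply, LinearEquiv.symm_apply_apply]
    exact hS h v
  simp only [Representation.character]
  rw [he, LinearMap.trace_conj']

/-- if `x̄` has odd order in `G/N` and `θ ∈ Irr(N)` is real, `x`-invariant and
invariant under `C_G(x̄)`, then `θ` has a unique real extension `θ_x` to `N⟨x⟩`, and `θ_x`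
is invariant under every element of `C_G(x̄)` (i.e. `x̄` is good for `θ`). -/
theorem stmt19 {G : Type*} [Group G] [Fintype G] (N : Subgroup G) [N.Normal]
    (θ : ↥N → ℂ) (hθ : IsIrrChar ↥N θ) (hreal : IsRealChar ↥N θ) (x : G)
    (hodd : Odd (orderOf (QuotientGroup.mk x : G ⧸ N)))
    (hx : conjChar N θ x = θ)
    (hC : ∀ c : G, x⁻¹ * c⁻¹ * x * c ∈ N → conjChar N θ c = θ) :
    ∃ θx : ↥(N ⊔ Subgroup.zpowers x) → ℂ,
      (IsChar ↥(N ⊔ Subgroup.zpowers x) θx ∧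
        IsRealChar ↥(N ⊔ Subgroup.zpowers x) θx ∧
        ∀ n : ↥N, θx ⟨↑n, (le_sup_left : N ≤ N ⊔ Subgroup.zpowers x) n.2⟩ = θ n) ∧
      (∀ ψ : ↥(N ⊔ Subgroup.zpowers x) → ℂ,
        IsChar ↥(N ⊔ Subgroup.zpowers x) ψ →
        IsRealChar ↥(N ⊔ Subgroup.zpowers x) ψ →
        (∀ n : ↥N, ψ ⟨↑n, (le_sup_left : N ≤ N ⊔ Subgroup.zpowers x) n.2⟩ = θ n) →
        ψ = θx) ∧
      (∀ c : G, x⁻¹ * c⁻¹ * x * c ∈ N →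
        ∀ h : ↥(N ⊔ Subgroup.zpowers x),
          ext0 (N ⊔ Subgroup.zpowers x) θx (c * ↑h * c⁻¹) = θx h) := by
  obtain ⟨⟨n, ρ, hρ⟩, hnorm⟩ := hθ
  have hρ' : ∀ g, ρ.character g = θ g := fun g => (hρ g).symm
  have hconj : ∀ g : ↥N, θ (MulAut.conjNormal x g) = θ g := by
    intro g
    have h := congrFun hx g
    have hm : x * (g : G) * x⁻¹ ∈ N := (MulAut.conjNormal x g).2
    rw [conjChar, ext0, dif_pos hm] at h
    exact h
  obtain ⟨σ, hσN, hσr⟩ := s19_existence N x hodd ρ (by simpa only [hρ'] using hnorm)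
    (by simpa only [hρ', IsRealChar] using hreal) (by simpa only [hρ'] using hconj)
  have hσθ : ∀ g : ↥N, σ.character (Subgroup.inclusion le_sup_left g) = θ g := by
    intro g
    rw [← hρ', Representation.character, hσN]
    rfl
  have huniq : ∀ ψ : ↥(N ⊔ Subgroup.zpowers x) → ℂ,
        IsChar ↥(N ⊔ Subgroup.zpowers x) ψ →
        IsRealChar ↥(N ⊔ Subgroup.zpowers x) ψ →
        (∀ n : ↥N, ψ ⟨↑n, (le_sup_left : N ≤ N ⊔ Subgroup.zpowers x) n.2⟩ = θ n) →
        ψ = σ.character := by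
    rintro ψ ⟨n', σ', hσ'⟩ hψr hψN
    have hψ : ψ = σ'.character := funext hσ'
    subst hψ
    exact s19_unique N x hodd θ hnorm hreal σ' σ hψN hσθ hψr hσr
  refine ⟨σ.character, ⟨⟨n, σ, fun _ => rfl⟩, hσr, hσθ⟩, huniq, ?_⟩
  intro c hc h
  have hmem : ∀ y ∈ N ⊔ Subgroup.zpowers x, c * y * c⁻¹ ∈ N ⊔ Subgroup.zpowers x := by
    have hle : N ⊔ Subgroup.zpowers x ≤
        (N ⊔ Subgroup.zpowers x).comap (MulAut.conj c).toMonoidHom := by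
      refine sup_le (fun y hy => ?_) ?_
      · exact (le_sup_left : N ≤ N ⊔ Subgroup.zpowers x)
          ((inferInstance : N.Normal).conj_mem y hy c)
      · rw [Subgroup.zpowers_le]
        change c * x * c⁻¹ ∈ N ⊔ Subgroup.zpowers x
        have h1 : c * x * c⁻¹ = x * (c * (x⁻¹ * c⁻¹ * x * c) * c⁻¹)⁻¹ := by group
        rw [h1]
        exact mul_mem ((le_sup_right : _ ≤ N ⊔ Subgroup.zpowers x) (Subgroup.mem_zpowers x))
          ((le_sup_left : N ≤ N ⊔ Subgroup.zpowers x)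
            (inv_mem ((inferInstance : N.Normal).conj_mem _ hc c)))
    exact fun y hy => hle hy
  let κ : ↥(N ⊔ Subgroup.zpowers x) →* ↥(N ⊔ Subgroup.zpowers x) :=
    { toFun := fun y => ⟨c * y * c⁻¹, hmem y y.2⟩
      map_one' := by ext; simp
      map_mul' := fun a b => by ext; simp }
  rw [ext0, dif_pos (hmem h h.2)]
  have key := huniq (fun y => σ.character (κ y)) ⟨n, σ.comp κ, fun _ => rfl⟩ (fun y => hσr _)
    (by
      intro g
      have hg := congrFun (hC c hc) g
      have hm : c * (g : G) * c⁻¹ ∈ N := (inferInstance : N.Normal).conj_mem g g.2 c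
      rw [conjChar, ext0, dif_pos hm] at hg
      rw [← hg, ← hσθ]
      rfl)
  exact congrFun key h
end
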